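/- Let n ∈ ℕ, r > 0, and let f : ℝⁿ → ℝⁿ be continuously differentiable with f(0) = 0, ‖Df(y)‖ ≤ L (operator norm) for all y ∈ B_{2r}, and ‖f(y)‖ ≤ Q for all y ∈ B_{2r}. Let T > 0 satisfy T·Q < r and T·L < 1. Then for every integer k ≥ 1, every x ∈ B_r, and every t ∈ [0,T]: ‖(D_x(Pᵏ 0)(t,·))(x)[f(x)] − ∂/∂t (Pᵏ 0)(t,x)‖ ≤ ((T·L)ᵏ / T)·‖x‖, where D_x(Pᵏ 0)(t,·)(x) denotes the Fréchet derivative of x' ↦ (Pᵏ 0)(t,x') at x. -/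

import Mathlib

/-- The Picard operator acting on functions `z : ℝ × ℝⁿ → ℝⁿ`:
`(P z)(t,x) = x + ∫₀ᵗ f(z(s,x)) ds`. -/
noncomputable def picardT {n : ℕ} (f : EuclideanSpace ℝ (Fin n) → EuclideanSpace ℝ (Fin n))
    (z : ℝ → EuclideanSpace ℝ (Fin n) → EuclideanSpace ℝ (Fin n)) :
    ℝ → EuclideanSpace ℝ (Fin n) → EuclideanSpace ℝ (Fin n) :=
  fun t x => x + ∫ s in (0:ℝ)..t, f (z s x)

/-- Differentiation under an interval integral whose integrand has a jointly continuous partial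
derivative in the parameter. -/
theorem hasFDerivAt_intervalIntegral_of_continuous {H E : Type*} [NormedAddCommGroup H]
    [NormedSpace ℝ H] [ProperSpace H] [NormedAddCommGroup E] [NormedSpace ℝ E]
    {F : ℝ → H → E} {F' : ℝ → H → H →L[ℝ] E} (hF : ∀ x, Continuous fun s => F s x)
    (hF' : Continuous fun p : ℝ × H => F' p.1 p.2)
    (hd : ∀ s x, HasFDerivAt (F s) (F' s x) x) (a b : ℝ) (x : H) :
    HasFDerivAt (fun x => ∫ s in a..b, F s x) (∫ s in a..b, F' s x) x := by
  obtain ⟨C, hC⟩ := ((isCompact_uIcc (a := a) (b := b)).prod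
    (isCompact_closedBall x 1)).exists_bound_of_continuousOn hF'.continuousOn
  have hx : Continuous fun s => F' s x := hF'.comp (Continuous.prodMk_left x)
  refine intervalIntegral.hasFDerivAt_integral_of_dominated_of_fderiv_le
    (F := fun x s => F s x) (F' := fun x s => F' s x) (bound := fun _ => C)
    (Metric.closedBall_mem_nhds x one_pos)
    (.of_forall fun y => (hF y).aestronglyMeasurable) ((hF x).intervalIntegrable _ _)
    hx.aestronglyMeasurable (.of_forall fun s hs y hy => ?_) intervalIntegrable_const
    (.of_forall fun s _ y _ => hd s y)
  exact hC (s, y) ⟨Set.uIoc_subset_uIcc hs, hy⟩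

/-- Joint continuity of a curve of maps together with continuous differentiability in space. -/
structure IsSpatiallyC1 {n : ℕ}
    (z : ℝ → EuclideanSpace ℝ (Fin n) → EuclideanSpace ℝ (Fin n)) : Prop where
  continuous : Continuous fun p : ℝ × EuclideanSpace ℝ (Fin n) => z p.1 p.2
  differentiable : ∀ t, Differentiable ℝ (z t)
  continuous_fderiv :
    Continuous fun p : ℝ × EuclideanSpace ℝ (Fin n) => fderiv ℝ (z p.1) p.2

section Picard

variable {n : ℕ} {f : EuclideanSpace ℝ (Fin n) → EuclideanSpace ℝ (Fin n)}
  {z : ℝ → EuclideanSpace ℝ (Fin n) → EuclideanSpace ℝ (Fin n)}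

theorem IsSpatiallyC1.continuous_left (hz : IsSpatiallyC1 z) (x : EuclideanSpace ℝ (Fin n)) :
    Continuous fun s => z s x :=
  hz.continuous.comp (Continuous.prodMk_left x)

theorem IsSpatiallyC1.continuous_fderiv_left (hz : IsSpatiallyC1 z)
    (x : EuclideanSpace ℝ (Fin n)) : Continuous fun s => fderiv ℝ (z s) x :=
  hz.continuous_fderiv.comp (Continuous.prodMk_left x)

theorem isSpatiallyC1_zero :
    IsSpatiallyC1 (0 : ℝ → EuclideanSpace ℝ (Fin n) → EuclideanSpace ℝ (Fin n)) where
  continuous := continuous_const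
  differentiable _ := differentiable_const 0
  continuous_fderiv := by
    simpa using continuous_const

theorem hasFDerivAt_picardT (hf : ContDiff ℝ 1 f) (hz : IsSpatiallyC1 z) (t : ℝ)
    (x : EuclideanSpace ℝ (Fin n)) :
    HasFDerivAt (picardT f z t) (ContinuousLinearMap.id ℝ _ +
      ∫ s in (0 : ℝ)..t, (fderiv ℝ f (z s x)).comp (fderiv ℝ (z s) x)) x := by
  refine (hasFDerivAt_id x).add (hasFDerivAt_intervalIntegral_of_continuous
    (F := fun s x => f (z s x))
    (F' := fun s x => (fderiv ℝ f (z s x)).comp (fderiv ℝ (z s) x))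
    (fun y => hf.continuous.comp (hz.continuous_left y)) ?_ (fun s y => ?_) 0 t x)
  · exact ((hf.continuous_fderiv one_ne_zero).comp hz.continuous).clm_comp hz.continuous_fderiv
  · exact (hf.differentiable one_ne_zero _).hasFDerivAt.comp y (hz.differentiable s y).hasFDerivAt

theorem IsSpatiallyC1.picardT (hf : ContDiff ℝ 1 f) (hz : IsSpatiallyC1 z) :
    IsSpatiallyC1 (picardT f z) where
  continuous := continuous_snd.add
    (intervalIntegral.continuous_parametric_intervalIntegral_of_continuous
      (f := fun (p : ℝ × EuclideanSpace ℝ (Fin n)) s => f (z s p.2))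
      (hf.continuous.comp (hz.continuous.comp
        (continuous_snd.prodMk (continuous_snd.comp continuous_fst)))) continuous_fst)
  differentiable t x := (hasFDerivAt_picardT hf hz t x).differentiableAt
  continuous_fderiv := by
    simp only [(hasFDerivAt_picardT hf hz _ _).fderiv]
    refine continuous_const.add
      (intervalIntegral.continuous_parametric_intervalIntegral_of_continuous
        (f := fun (p : ℝ × EuclideanSpace ℝ (Fin n)) s =>
          (fderiv ℝ f (z s p.2)).comp (fderiv ℝ (z s) p.2)) ?_ continuous_fst)
    have h : Continuous fun q : (ℝ × EuclideanSpace ℝ (Fin n)) × ℝ => (q.2, q.1.2) :=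
      continuous_snd.prodMk (continuous_snd.comp continuous_fst)
    exact ((hf.continuous_fderiv one_ne_zero).comp (hz.continuous.comp h)).clm_comp
      (hz.continuous_fderiv.comp h)

theorem isSpatiallyC1_iterate_picardT (hf : ContDiff ℝ 1 f) (k : ℕ) :
    IsSpatiallyC1 ((picardT f)^[k] 0) := by
  induction k with
  | zero => exact isSpatiallyC1_zero
  | succ k ih => rw [Function.iterate_succ_apply']; exact ih.picardT hf

theorem hasDerivAt_picardT (hf : Continuous f) (hz : IsSpatiallyC1 z)
    (x : EuclideanSpace ℝ (Fin n)) (t : ℝ) :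
    HasDerivAt (fun t => picardT f z t x) (f (z t x)) t :=
  (intervalIntegral.integral_hasDerivAt_right
    ((hf.comp (hz.continuous_left x)).intervalIntegrable 0 t)
    (hf.comp (hz.continuous_left x)).aestronglyMeasurable.stronglyMeasurableAtFilter
    (hf.comp (hz.continuous_left x)).continuousAt).const_add x

/-- Applying the Picard operator to `picardT f z` integrates the derivative defect along it. -/
theorem fderiv_picardT_picardT_sub (hf : ContDiff ℝ 1 f) (hz : IsSpatiallyC1 z)
    (x : EuclideanSpace ℝ (Fin n)) (t : ℝ) :
    fderiv ℝ (picardT f (picardT f z) t) x (f x) - f (picardT f z t x) =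
      ∫ s in (0 : ℝ)..t, fderiv ℝ f (picardT f z s x)
        (fderiv ℝ (picardT f z s) x (f x) - f (z s x)) := by
  have hw := hz.picardT hf
  have hA : Continuous fun s => fderiv ℝ f (picardT f z s x) :=
    (hf.continuous_fderiv one_ne_zero).comp (hw.continuous_left x)
  have hB : Continuous fun s => fderiv ℝ (picardT f z s) x := hw.continuous_fderiv_left x
  have hC : Continuous fun s => f (z s x) := hf.continuous.comp (hz.continuous_left x)
  have hftc : ∫ s in (0 : ℝ)..t, fderiv ℝ f (picardT f z s x) (f (z s x)) =
      f (picardT f z t x) - f x := by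
    rw [intervalIntegral.integral_eq_sub_of_hasDerivAt
      (f := fun s => f (picardT f z s x))
      (fun s _ => (hf.differentiable one_ne_zero _).hasFDerivAt.comp_hasDerivAt s
        (hasDerivAt_picardT hf.continuous hz x s))
      ((hA.clm_apply hC).intervalIntegrable _ _)]
    simp [picardT]
  simp only [map_sub]
  rw [intervalIntegral.integral_sub
    ((hA.clm_apply (hB.clm_apply continuous_const)).intervalIntegrable _ _)
    ((hA.clm_apply hC).intervalIntegrable _ _), hftc,
    (hasFDerivAt_picardT hf hw t x).fderiv, add_apply,
    ContinuousLinearMap.intervalIntegral_apply ((hA.clm_comp hB).intervalIntegrable _ _)]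
  simp only [ContinuousLinearMap.id_apply, ContinuousLinearMap.comp_apply]
  abel

/-- The Picard operator preserves the bound `‖z‖ ≤ 2r` over `[0, T] × B_r`. -/
theorem norm_iterate_picardT_le {r Q T : ℝ} (hr : 0 ≤ r) (hQ : 0 ≤ Q) (hTQ : T * Q ≤ r)
    (hfQ : ∀ y ∈ Metric.closedBall (0 : EuclideanSpace ℝ (Fin n)) (2 * r), ‖f y‖ ≤ Q)
    {x : EuclideanSpace ℝ (Fin n)} (hx : ‖x‖ ≤ r) (k : ℕ) {t : ℝ} (ht : t ∈ Set.Icc 0 T) :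
    ‖(picardT f)^[k] 0 t x‖ ≤ 2 * r := by
  induction k generalizing t with
  | zero => simpa using hr
  | succ k ih =>
    rw [Function.iterate_succ_apply']
    have h : ‖∫ s in (0 : ℝ)..t, f ((picardT f)^[k] 0 s x)‖ ≤ Q * |t - 0| := by
      refine intervalIntegral.norm_integral_le_of_norm_le_const fun s hs => hfQ _ ?_
      rw [Set.uIoc_of_le ht.1] at hs
      exact mem_closedBall_zero_iff.2 (ih ⟨hs.1.le, hs.2.trans ht.2⟩)
    rw [sub_zero, abs_of_nonneg ht.1] at h
    have h' : Q * t ≤ T * Q := by nlinarith [ht.2]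
    calc ‖picardT f ((picardT f)^[k] 0) t x‖
        ≤ ‖x‖ + ‖∫ s in (0 : ℝ)..t, f ((picardT f)^[k] 0 s x)‖ := norm_add_le _ _
      _ ≤ 2 * r := by linarith

end Picard

/-- the derivative inequality for the Picard iterates,
`‖D_x(Pᵏ0)(t,·)(x)[f(x)] − ∂_t(Pᵏ0)(t,x)‖ ≤ ((TL)ᵏ/T)·‖x‖`. -/
theorem picard_derivative_inequality {n : ℕ} (r Q L T : ℝ) (hr : 0 < r) (hQ : 0 < Q)
    (hL : 0 < L)
    (f : EuclideanSpace ℝ (Fin n) → EuclideanSpace ℝ (Fin n))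
    (hf : ContDiff ℝ 1 f) (hf0 : f 0 = 0)
    (hfD : ∀ y ∈ Metric.closedBall (0 : EuclideanSpace ℝ (Fin n)) (2 * r),
      ‖fderiv ℝ f y‖ ≤ L)
    (hfQ : ∀ y ∈ Metric.closedBall (0 : EuclideanSpace ℝ (Fin n)) (2 * r), ‖f y‖ ≤ Q)
    (hT : 0 < T) (hTQ : T * Q < r) (hTL : T * L < 1) :
    ∀ k : ℕ, 1 ≤ k →
      ∀ x ∈ Metric.closedBall (0 : EuclideanSpace ℝ (Fin n)) r,
        ∀ t ∈ Set.Icc (0:ℝ) T,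
          ‖fderiv ℝ (fun x' => (picardT f)^[k] 0 t x') x (f x) -
              deriv (fun t' => (picardT f)^[k] 0 t' x) t‖ ≤ (T * L) ^ k / T * ‖x‖ := by
  intro k hk x hx t ht
  rw [mem_closedBall_zero_iff] at hx
  induction k, hk using Nat.le_induction generalizing t with
  | base =>
    have hz : ∀ t', (fun x' => (picardT f)^[1] 0 t' x') = id := fun t' => by
      ext1 x'
      simp [picardT, hf0]
    have hz' : (fun t' => (picardT f)^[1] 0 t' x) = fun _ => x := by
      ext1 t'
      exact congrFun (hz t') x
    rw [hz, hz', fderiv_id, deriv_const, pow_one, mul_div_cancel_left₀ _ hT.ne']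
    simpa [hf0] using (convex_closedBall (0 : EuclideanSpace ℝ (Fin n))
      (2 * r)).norm_image_sub_le_of_norm_fderiv_le
      (fun y _ => hf.differentiable one_ne_zero y) hfD
      (Metric.mem_closedBall_self (by linarith)) (mem_closedBall_zero_iff.2 (by linarith))
  | succ k hk ih =>
    obtain ⟨j, rfl⟩ := Nat.exists_eq_add_of_le' hk
    have hz := isSpatiallyC1_iterate_picardT hf j
    have hball : ∀ s ∈ Set.Icc 0 T, ‖(picardT f)^[j + 1] 0 s x‖ ≤ 2 * r := fun s hs =>
      norm_iterate_picardT_le hr.le hQ.le hTQ.le hfQ hx (j + 1) hs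
    rw [Function.iterate_succ_apply'] at ih hball
    simp only [(hasDerivAt_picardT hf.continuous hz x _).deriv] at ih
    rw [Function.iterate_succ_apply', Function.iterate_succ_apply',
      (hasDerivAt_picardT hf.continuous (hz.picardT hf) x t).deriv,
      fderiv_picardT_picardT_sub hf hz x t]
    have h := intervalIntegral.norm_integral_le_of_norm_le_const (a := 0) (b := t)
      (C := L * ((T * L) ^ (j + 1) / T * ‖x‖))
      (f := fun s => fderiv ℝ f (picardT f ((picardT f)^[j] 0) s x)
        (fderiv ℝ (picardT f ((picardT f)^[j] 0) s) x (f x) - f ((picardT f)^[j] 0 s x)))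
      fun s hs => by
        rw [Set.uIoc_of_le ht.1] at hs
        have hs' : s ∈ Set.Icc 0 T := ⟨hs.1.le, hs.2.trans ht.2⟩
        exact ContinuousLinearMap.le_of_opNorm_le_of_le _
          (hfD _ (mem_closedBall_zero_iff.2 (hball s hs'))) (ih s hs')
    rw [sub_zero, abs_of_nonneg ht.1] at h
    calc _ ≤ L * ((T * L) ^ (j + 1) / T * ‖x‖) * t := h
      _ ≤ L * ((T * L) ^ (j + 1) / T * ‖x‖) * T := by gcongr; exact ht.2
      _ = (T * L) ^ (j + 1 + 1) / T * ‖x‖ := by ring
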